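/- Let α > 0, let γ satisfy 0 < γ < min(1, α), let u_0 ∈ ℝ, and let f : {p^k : k ∈ ℤ} × ℝ → ℝ satisfy |f(r, x)| ≤ M and |f(r, x) − f(r, y)| ≤ F |x − y| for all r and all x, y ∈ ℝ. Then there exist N ∈ ℤ and a radial function u defined on the ball {t : |t|_p ≤ p^N} with u(0) = u_0 such that for every nonzero t with |t|_p ≤ p^N the integral defining (I^α [ f̃(|·|_p, u(|·|_p)) ])(|t|_p) converges absolutely and u(|t|_p) = u_0 + (I^α [ f̃(|·|_p, u(|·|_p)) ])(|t|_p); that is, the degenerate Cauchy problem |t|_p^{γ} (D^α u)(|t|_p) = f(|t|_p, u(|t|_p)), u(0) = u_0, has a local mild solution. -/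

import Mathlib

open MeasureTheory Metric

noncomputable section

variable (p : ℕ) [Fact p.Prime]

instance : MeasurableSpace ℚ_[p] := borel _
instance : BorelSpace ℚ_[p] := ⟨rfl⟩

/-- The closed unit ball of `ℚ_[p]` as a positive compact set. -/
def unitBallPC : TopologicalSpace.PositiveCompacts ℚ_[p] where
  carrier := closedBall 0 1
  isCompact' := isCompact_closedBall 0 1
  interior_nonempty' := ⟨0, mem_interior_iff_mem_nhds.2
    (Filter.mem_of_superset (ball_mem_nhds 0 one_pos) ball_subset_closedBall)⟩

/-- The Haar measure on `ℚ_[p]` normalized so the unit ball has measure 1. -/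
def padicHaar : Measure ℚ_[p] := Measure.addHaarMeasure (unitBallPC p)

/-- A point on the sphere of radius `p^k`. -/
def sph (k : ℤ) : ℚ_[p] := (p : ℚ_[p]) ^ (-k)

/-- A function is radial if it depends only on the p-adic absolute value. -/
def Radial (u : ℚ_[p] → ℝ) : Prop := ∀ x y : ℚ_[p], ‖x‖ = ‖y‖ → u x = u y

/-- The integrand of the Vladimirov operator `D^α` at `x`. -/
def Dker (α : ℝ) (u : ℚ_[p] → ℝ) (x : ℚ_[p]) : ℚ_[p] → ℝ :=
  fun y => ‖y‖ ^ (-α - 1) * (u (x - y) - u x)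

/-- The Vladimirov fractional differentiation operator. -/
def Dop (α : ℝ) (u : ℚ_[p] → ℝ) (x : ℚ_[p]) : ℝ :=
  ((1 - (p : ℝ) ^ α) / (1 - (p : ℝ) ^ (-α - 1))) * ∫ y, Dker p α u x y ∂(padicHaar p)

/-- The kernel of the fractional integral `I^α`. -/
def Iker (α : ℝ) (x y : ℚ_[p]) : ℝ :=
  if α = 1 then Real.log ‖x - y‖ - Real.log ‖y‖
  else ‖x - y‖ ^ (α - 1) - ‖y‖ ^ (α - 1)

/-- The constant in front of the fractional integral. -/
def Icoef (α : ℝ) : ℝ :=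
  if α = 1 then (1 - (p : ℝ)) / (p * Real.log p)
  else (1 - (p : ℝ) ^ (-α)) / (1 - (p : ℝ) ^ (α - 1))

/-- The p-adic fractional integral `I^α`. -/
def Iop (α : ℝ) (u : ℚ_[p] → ℝ) (x : ℚ_[p]) : ℝ :=
  Icoef p α * ∫ y in {y : ℚ_[p] | ‖y‖ ≤ ‖x‖}, Iker p α x y * u y ∂(padicHaar p)

end


instance padicHaar_isAddHaar (p : ℕ) [Fact p.Prime] : (padicHaar p).IsAddHaarMeasure := by
  unfold padicHaar; infer_instance

lemma padicHaar_ball_one (p : ℕ) [Fact p.Prime] : padicHaar p (closedBall 0 1) = 1 :=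
  Measure.addHaarMeasure_self (K₀ := unitBallPC p)

lemma padicHaar_ball_le (p : ℕ) [Fact p.Prime] (n : ℕ) :
    padicHaar p (closedBall 0 ((p : ℝ) ^ (-n : ℤ))) ≤ ENNReal.ofReal ((p : ℝ) ^ (-n : ℤ)) := by
  have hp : (0 : ℝ) < p := by exact_mod_cast (Fact.out : p.Prime).pos
  have hp1 : (1 : ℝ) ≤ p := by exact_mod_cast (Fact.out : p.Prime).one_le
  set r : ℝ := (p : ℝ) ^ (-n : ℤ) with hr
  have hr1 : r ≤ 1 := by
    rw [hr, zpow_neg, zpow_natCast]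
    exact inv_le_one_of_one_le₀ (one_le_pow₀ hp1)
  have hsum : ∑ i ∈ Finset.range (p ^ n), padicHaar p (closedBall (i : ℚ_[p]) r)
      ≤ padicHaar p (closedBall 0 1) := by
    rw [← measure_biUnion_finset]
    · apply measure_mono
      intro x hx
      simp only [Set.mem_iUnion, mem_closedBall, dist_eq_norm] at hx ⊢
      obtain ⟨i, hi, hx⟩ := hx
      have h1 : ‖(i : ℚ_[p])‖ ≤ 1 := by
        simpa using Padic.norm_int_le_one (p := p) (i : ℤ)
      have := Padic.nonarchimedean (x - (i : ℚ_[p])) (i : ℚ_[p])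
      simp only [sub_add_cancel] at this
      rw [sub_zero]
      exact this.trans (max_le (hx.trans hr1) h1)
    · intro i hi j hj hij
      rw [Function.onFun, Set.disjoint_left]
      intro x hx hy
      apply hij
      simp only [mem_closedBall, dist_eq_norm] at hx hy
      have h3 : ‖(((i : ℤ) - (j : ℤ) : ℤ) : ℚ_[p])‖ ≤ r := by
        have := Padic.nonarchimedean (x - (j : ℚ_[p])) (-(x - (i : ℚ_[p])))
        rw [norm_neg] at this
        have e : (((i : ℤ) - (j : ℤ) : ℤ) : ℚ_[p]) = (x - j) + (-(x - (i : ℚ_[p]))) := by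
          push_cast; ring
        rw [e]
        exact this.trans (max_le hy hx)
      rw [hr, Padic.norm_int_le_pow_iff_dvd] at h3
      simp only [Finset.coe_range, Set.mem_Iio] at hi hj
      have h4 : (i : ℤ) - j = 0 := by
        apply Int.eq_zero_of_abs_lt_dvd h3
        have : (i : ℤ) < (p : ℤ) ^ n := by exact_mod_cast hi
        have : (j : ℤ) < (p : ℤ) ^ n := by exact_mod_cast hj
        push_cast
        rw [abs_lt]; constructor <;> omega
      omega
    · intro i _
      exact isClosed_closedBall.measurableSet
  have hconst : ∀ i ∈ Finset.range (p ^ n), padicHaar p (closedBall (i : ℚ_[p]) r)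
      = padicHaar p (closedBall 0 r) := by
    intro i _
    have := measure_preimage_add_right (padicHaar p) (-(i : ℚ_[p])) (closedBall 0 r)
    rw [← this]
    congr 1
    ext x
    simp [dist_eq_norm, sub_eq_add_neg]
  rw [Finset.sum_congr rfl hconst, padicHaar_ball_one, Finset.sum_const, Finset.card_range,
    nsmul_eq_mul] at hsum
  have hr2 : ENNReal.ofReal r = ((p ^ n : ℕ) : ENNReal)⁻¹ := by
    rw [hr, zpow_neg, zpow_natCast, ENNReal.ofReal_inv_of_pos (by positivity)]
    congr 1
    rw [← Nat.cast_pow, ENNReal.ofReal_natCast]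
  rw [hr2, ENNReal.le_inv_iff_mul_le, mul_comm]
  exact hsum

lemma padicHaar_map (p : ℕ) [Fact p.Prime] (t : ℚ_[p]) (ht : t ≠ 0) :
    (padicHaar p).map (fun y => t⁻¹ * y) = padicHaar p (closedBall 0 ‖t‖) • padicHaar p := by
  have ht' : t⁻¹ ≠ 0 := inv_ne_zero ht
  let e : ℚ_[p] ≃ₜ ℚ_[p] := Homeomorph.mulLeft₀ t⁻¹ ht'
  have : ((padicHaar p).map (fun y => t⁻¹ * y)).IsAddHaarMeasure := by
    refine Measure.isAddHaarMeasure_map (padicHaar p) (AddMonoidHom.mulLeft t⁻¹)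
      e.continuous e.surjective ?_
    exact e.isClosedEmbedding.tendsto_cocompact
  have h := Measure.addHaarMeasure_unique ((padicHaar p).map (fun y => t⁻¹ * y)) (unitBallPC p)
  rw [h]
  congr 1
  rw [Measure.map_apply (by fun_prop)]
  · congr 1
    ext y
    simp only [mem_closedBall, dist_zero_right]
    change y ∈ (fun y => t⁻¹ * y) ⁻¹' (closedBall 0 1) ↔ _
    have : 0 < ‖t‖ := norm_pos_iff.2 ht
    simp only [Set.mem_preimage, mem_closedBall, dist_zero_right, norm_mul, norm_inv]
    rw [inv_mul_le_iff₀ this, mul_one]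
  · exact (unitBallPC p).isCompact.isClosed.measurableSet

lemma padic_valuation_eq_floor (p : ℕ) [Fact p.Prime] (z : ℚ_[p]) :
    z.valuation = ⌊-Real.logb p ‖z‖⌋ := by
  have hp1 : (1 : ℝ) < p := by exact_mod_cast (Fact.out : p.Prime).one_lt
  by_cases hz : z = 0
  · simp [hz]
  · rw [Padic.norm_eq_zpow_neg_valuation hz, ← Real.rpow_intCast, Real.logb_rpow (by linarith) hp1.ne']
    simp

lemma measurable_padic_valuation (p : ℕ) [Fact p.Prime] :
    Measurable (fun z : ℚ_[p] => z.valuation) := by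
  simp_rw [padic_valuation_eq_floor]
  apply Int.measurable_floor.comp
  unfold Real.logb
  exact ((Real.measurable_log.comp measurable_norm).div_const _).neg

/-- Integrability of a negative power of the norm on the unit ball. -/
lemma integrableOn_norm_rpow (p : ℕ) [Fact p.Prime] (s : ℝ) (hs0 : 0 < s) (hs : s < 1) :
    IntegrableOn (fun z : ℚ_[p] => ‖z‖ ^ (-s)) {z | ‖z‖ ≤ 1} (padicHaar p) := by
  have hp : (0 : ℝ) < p := by exact_mod_cast (Fact.out : p.Prime).pos
  have hp1 : (1 : ℝ) < p := by exact_mod_cast (Fact.out : p.Prime).one_lt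
  have hms : MeasurableSet {z : ℚ_[p] | ‖z‖ ≤ 1} :=
    measurableSet_le measurable_norm measurable_const
  have hmeas : Measurable (fun z : ℚ_[p] => ‖z‖ ^ (-s)) := measurable_norm.pow_const _
  refine ⟨hmeas.aestronglyMeasurable, ?_⟩
  rw [hasFiniteIntegral_iff_ofReal (Filter.Eventually.of_forall fun z => by positivity)]
  let q : ℝ := (p : ℝ) ^ (s - 1)
  have hq0 : 0 < q := by positivity
  have hq1 : q < 1 := Real.rpow_lt_one_of_one_lt_of_neg hp1 (by linarith)
  let b : ℕ → ℚ_[p] → ENNReal := fun n =>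
    (closedBall (0 : ℚ_[p]) ((p : ℝ) ^ (-n : ℤ))).indicator
      (fun _ => ENNReal.ofReal (((p : ℝ) ^ s) ^ n))
  calc ∫⁻ z in {z : ℚ_[p] | ‖z‖ ≤ 1}, ENNReal.ofReal (‖z‖ ^ (-s)) ∂padicHaar p
      ≤ ∫⁻ z in {z : ℚ_[p] | ‖z‖ ≤ 1}, ∑' n, b n z ∂padicHaar p := by
        refine setLIntegral_mono' hms ?_
        intro z hz
        by_cases h0 : z = 0
        · simp [h0, Real.zero_rpow (by linarith : -s ≠ 0)]
        · have hz' : ‖z‖ ≤ 1 := hz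
          have hv := Padic.norm_eq_zpow_neg_valuation h0
          have hv0 : 0 ≤ z.valuation := by
            by_contra hneg
            push Not at hneg
            have : 1 < (p : ℝ) ^ (-z.valuation) := one_lt_zpow₀ hp1 (by omega)
            linarith
          obtain ⟨n, hn⟩ := Int.eq_ofNat_of_zero_le hv0
          rw [hn] at hv
          refine le_trans (le_of_eq ?_) (ENNReal.le_tsum n)
          have hmem : z ∈ closedBall (0 : ℚ_[p]) ((p : ℝ) ^ (-n : ℤ)) := by
            simp [hv]
          simp only [b, Set.indicator_of_mem hmem]
          congr 1
          rw [hv, ← Real.rpow_intCast, ← Real.rpow_natCast, ← Real.rpow_mul hp.le,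
            ← Real.rpow_mul hp.le]
          congr 1
          push_cast; ring
    _ ≤ ∫⁻ z, ∑' n, b n z ∂padicHaar p := setLIntegral_le_lintegral _ _
    _ = ∑' n, ∫⁻ z, b n z ∂padicHaar p := by
        apply lintegral_tsum
        intro n
        exact (measurable_const.indicator isClosed_closedBall.measurableSet).aemeasurable
    _ ≤ ∑' n : ℕ, ENNReal.ofReal (q ^ n) := by
        refine ENNReal.tsum_le_tsum fun n => ?_
        simp only [b]
        rw [lintegral_indicator_const isClosed_closedBall.measurableSet]
        refine (mul_le_mul_right (padicHaar_ball_le p n) _).trans (le_of_eq ?_)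
        rw [← ENNReal.ofReal_mul (by positivity)]
        congr 1
        simp only [q]
        rw [Real.rpow_sub_one hp.ne', div_pow, zpow_neg, zpow_natCast]
        rfl
    _ = ENNReal.ofReal (∑' n : ℕ, q ^ n) := by
        rw [ENNReal.ofReal_tsum_of_nonneg (fun n => by positivity)
          (summable_geometric_of_lt_one hq0.le hq1)]
    _ < ⊤ := ENNReal.ofReal_lt_top

lemma padic_norm_one_sub (p : ℕ) [Fact p.Prime] (z : ℚ_[p]) (hz : ‖z‖ < 1) : ‖1 - z‖ = 1 := by
  have h := Padic.add_eq_max_of_ne (p := p) (q := 1) (r := -z) (by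
    rw [norm_neg, norm_one]; exact hz.ne')
  rw [norm_neg, norm_one, max_eq_left hz.le] at h
  rw [sub_eq_add_neg, h]

lemma padic_norm_one_sub_le (p : ℕ) [Fact p.Prime] (z : ℚ_[p]) (hz : ‖z‖ ≤ 1) : ‖1 - z‖ ≤ 1 := by
  have h := Padic.nonarchimedean (p := p) 1 (-z)
  rw [norm_neg, norm_one, max_eq_left hz] at h
  rw [sub_eq_add_neg]; exact h

lemma rpow_bound (r e s : ℝ) (hr0 : 0 < r) (hr : r ≤ 1) (h : -s ≤ e) : r ^ e ≤ r ^ (-s) :=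
  Real.rpow_le_rpow_of_exponent_ge hr0 hr h

lemma abs_log_bound (r d : ℝ) (hr0 : 0 < r) (hr : r ≤ 1) (hd : 0 < d) :
    |Real.log r| ≤ 1 / d * r ^ (-d) := by
  have h := (Real.abs_log_mul_self_rpow_lt r d hr0 hr hd).le
  have hpos : 0 < r ^ d := by positivity
  rw [abs_mul, abs_of_pos hpos] at h
  rw [Real.rpow_neg hr0.le, ← div_eq_mul_inv, le_div_iff₀ hpos]
  exact h

lemma kernel_bound (p : ℕ) [Fact p.Prime] (α γ : ℝ)
    (hα : 0 < α) (hγ0 : 0 < γ) (hγ : γ < min 1 α) :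
    ∃ s C : ℝ, 0 < s ∧ s < 1 ∧ ∀ z : ℚ_[p], ‖z‖ ≤ 1 →
      |Iker p α 1 z * ‖z‖ ^ (-γ)| ≤ C * (‖z‖ ^ (-s) + ‖1 - z‖ ^ (-s)) := by
  have hγ1 : γ < 1 := lt_of_lt_of_le hγ (min_le_left _ _)
  have hγα : γ < α := lt_of_lt_of_le hγ (min_le_right _ _)
  by_cases h1 : α = 1
  · refine ⟨(1 + γ) / 2, 1 / ((1 - γ) / 2), by linarith, by linarith, ?_⟩
    have hd : 0 < (1 - γ) / 2 := by linarith
    have hC : 0 < 1 / ((1 - γ) / 2) := by positivity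
    intro z hz
    unfold Iker
    rw [if_pos h1]
    by_cases h0 : z = 0
    · subst h0
      simp only [norm_zero, Real.zero_rpow (by linarith : -γ ≠ 0), mul_zero, abs_zero]
      positivity
    have hz0 : 0 < ‖z‖ := norm_pos_iff.2 h0
    rcases hz.lt_or_eq with hlt | heq
    · rw [padic_norm_one_sub p z hlt, Real.log_one, zero_sub, abs_mul, abs_neg,
        abs_of_pos (by positivity : 0 < ‖z‖ ^ (-γ)), Real.one_rpow]
      have h := abs_log_bound ‖z‖ ((1 - γ) / 2) hz0 hz hd
      calc |Real.log ‖z‖| * ‖z‖ ^ (-γ)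
          ≤ (1 / ((1 - γ) / 2) * ‖z‖ ^ (-((1 - γ) / 2))) * ‖z‖ ^ (-γ) := by gcongr
        _ = 1 / ((1 - γ) / 2) * ‖z‖ ^ (-((1 + γ) / 2)) := by
            rw [mul_assoc, ← Real.rpow_add hz0]; congr 2; ring
        _ ≤ _ := by
            apply mul_le_mul_of_nonneg_left _ hC.le
            linarith
    · rw [heq, Real.log_one, sub_zero, Real.one_rpow, mul_one, Real.one_rpow]
      by_cases hz1 : 1 - z = 0
      · rw [hz1]; simp only [norm_zero, Real.log_zero, abs_zero]; positivity
      · have hp0 : 0 < ‖1 - z‖ := norm_pos_iff.2 hz1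
        have h := abs_log_bound ‖1 - z‖ ((1 - γ) / 2) hp0 (padic_norm_one_sub_le p z hz) hd
        refine h.trans (mul_le_mul_of_nonneg_left ?_ hC.le)
        have := rpow_bound ‖1 - z‖ (-((1 - γ) / 2)) ((1 + γ) / 2) hp0
          (padic_norm_one_sub_le p z hz) (by linarith)
        linarith
  · have hs0 : 0 < max γ (γ + 1 - α) := lt_max_of_lt_left hγ0
    refine ⟨max γ (γ + 1 - α), 2, hs0, max_lt hγ1 (by linarith), ?_⟩
    set s := max γ (γ + 1 - α) with hs
    have hsa : γ ≤ s := le_max_left _ _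
    have hsb : γ + 1 - α ≤ s := le_max_right _ _
    intro z hz
    unfold Iker
    rw [if_neg h1]
    by_cases h0 : z = 0
    · subst h0
      simp only [norm_zero, Real.zero_rpow (by linarith : -γ ≠ 0), mul_zero, abs_zero]
      positivity
    have hz0 : 0 < ‖z‖ := norm_pos_iff.2 h0
    rcases hz.lt_or_eq with hlt | heq
    · rw [padic_norm_one_sub p z hlt, Real.one_rpow, Real.one_rpow, sub_mul, one_mul,
        ← Real.rpow_add hz0]
      have e1 := rpow_bound ‖z‖ (-γ) s hz0 hz (by linarith)
      have e2 := rpow_bound ‖z‖ (α - 1 + -γ) s hz0 hz (by linarith)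
      have e3 : 0 < ‖z‖ ^ (-γ) := by positivity
      have e4 : 0 < ‖z‖ ^ (α - 1 + -γ) := by positivity
      rw [abs_le]; constructor <;> linarith
    · rw [heq, Real.one_rpow, Real.one_rpow, mul_one, Real.one_rpow]
      have e1 : ‖1 - z‖ ^ (α - 1) ≤ ‖1 - z‖ ^ (-s) := by
        by_cases hz1 : 1 - z = 0
        · rw [hz1, norm_zero, Real.zero_rpow (sub_ne_zero.2 h1)]; positivity
        · exact rpow_bound _ _ _ (norm_pos_iff.2 hz1) (padic_norm_one_sub_le p z hz) (by linarith)
      have e2 : 0 ≤ ‖1 - z‖ ^ (α - 1) := by positivity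
      rw [abs_le]; constructor <;> linarith

lemma measurable_Iker (p : ℕ) [Fact p.Prime] (α : ℝ) (t : ℚ_[p]) :
    Measurable (fun z : ℚ_[p] => Iker p α t z) := by
  unfold Iker
  have h1 : Measurable (fun z : ℚ_[p] => ‖t - z‖) := by fun_prop
  by_cases h : α = 1
  · simp only [if_pos h]
    exact (Real.measurable_log.comp h1).sub (Real.measurable_log.comp measurable_norm)
  · simp only [if_neg h]
    exact (h1.pow_const _).sub (measurable_norm.pow_const _)

lemma kernel_integrable (p : ℕ) [Fact p.Prime] (α γ : ℝ)
    (hα : 0 < α) (hγ0 : 0 < γ) (hγ : γ < min 1 α) :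
    IntegrableOn (fun z : ℚ_[p] => Iker p α 1 z * ‖z‖ ^ (-γ)) {z | ‖z‖ ≤ 1} (padicHaar p) := by
  obtain ⟨s, C, hs0, hs1, hb⟩ := kernel_bound p α γ hα hγ0 hγ
  have hms : MeasurableSet {z : ℚ_[p] | ‖z‖ ≤ 1} :=
    measurableSet_le measurable_norm measurable_const
  have i1 := integrableOn_norm_rpow p s hs0 hs1
  have i2 : IntegrableOn (fun z : ℚ_[p] => ‖1 - z‖ ^ (-s)) {z | ‖z‖ ≤ 1} (padicHaar p) := by
    have mp := Measure.measurePreserving_sub_left (padicHaar p) (1 : ℚ_[p])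
    have me : MeasurableEmbedding (fun z : ℚ_[p] => 1 - z) :=
      (Homeomorph.subLeft (1 : ℚ_[p])).measurableEmbedding
    have h := (mp.integrableOn_comp_preimage me).2 i1
    have hpre : (fun z : ℚ_[p] => 1 - z) ⁻¹' {z | ‖z‖ ≤ 1} = {z | ‖z‖ ≤ 1} := by
      ext z
      constructor
      · intro hz
        have := padic_norm_one_sub_le p (1 - z) hz
        simpa using this
      · intro hz
        exact padic_norm_one_sub_le p z hz
    rw [hpre] at h
    exact h
  refine Integrable.mono' ((i1.add i2).const_mul C) ?_ ?_
  · exact ((measurable_Iker p α 1).mul (measurable_norm.pow_const _)).aestronglyMeasurable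
  · rw [ae_restrict_iff' hms]
    exact Filter.Eventually.of_forall fun z hz => hb z hz

lemma Iker_scale (p : ℕ) [Fact p.Prime] (α : ℝ) (t z : ℚ_[p]) (ht : t ≠ 0) (hz : z ≠ 0)
    (hz1 : z ≠ 1) : Iker p α t (t * z) = ‖t‖ ^ (α - 1) * Iker p α 1 z := by
  have e : t - t * z = t * (1 - z) := by ring
  unfold Iker
  rw [e, norm_mul, norm_mul]
  split_ifs with h
  · have h1 : ‖t‖ ≠ 0 := norm_ne_zero_iff.2 ht
    have h2 : ‖z‖ ≠ 0 := norm_ne_zero_iff.2 hz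
    have h3 : ‖1 - z‖ ≠ 0 := norm_ne_zero_iff.2 (sub_ne_zero.2 (Ne.symm hz1))
    rw [Real.log_mul h1 h3, Real.log_mul h1 h2, h]
    simp
  · rw [Real.mul_rpow (norm_nonneg _) (norm_nonneg _), Real.mul_rpow (norm_nonneg _) (norm_nonneg _)]
    ring

lemma integrable_HW (p : ℕ) [Fact p.Prime] (α γ : ℝ)
    (hα : 0 < α) (hγ0 : 0 < γ) (hγ : γ < min 1 α) (W : ℤ → ℝ) (A : ℝ) (hW : ∀ l, |W l| ≤ A)
    (k : ℤ) :
    IntegrableOn (fun z : ℚ_[p] => Iker p α 1 z * ‖z‖ ^ (-γ) * W (k - z.valuation))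
      {z | ‖z‖ ≤ 1} (padicHaar p) := by
  have hm : Measurable (fun z : ℚ_[p] => W (k - z.valuation)) :=
    (measurable_from_top (f := fun l : ℤ => W (k - l))).comp (measurable_padic_valuation p)
  exact (kernel_integrable p α γ hα hγ0 hγ).mul_bdd hm.aestronglyMeasurable
    (Filter.Eventually.of_forall fun z => hW (k - z.valuation))

lemma scaling (p : ℕ) [Fact p.Prime] (α γ : ℝ)
    (hα : 0 < α) (hγ0 : 0 < γ) (hγ : γ < min 1 α) (W : ℤ → ℝ) (A : ℝ) (hW : ∀ l, |W l| ≤ A)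
    (t : ℚ_[p]) (ht : t ≠ 0) :
    IntegrableOn (fun y => Iker p α t y * (‖y‖ ^ (-γ) * W (-y.valuation)))
      {y : ℚ_[p] | ‖y‖ ≤ ‖t‖} (padicHaar p) ∧
    ∫ y in {y : ℚ_[p] | ‖y‖ ≤ ‖t‖}, Iker p α t y * (‖y‖ ^ (-γ) * W (-y.valuation)) ∂(padicHaar p)
      = (padicHaar p (closedBall 0 ‖t‖)).toReal * (‖t‖ ^ (α - 1 - γ) *
        ∫ z in {z : ℚ_[p] | ‖z‖ ≤ 1},
          Iker p α 1 z * ‖z‖ ^ (-γ) * W (-t.valuation - z.valuation) ∂(padicHaar p)) := by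
  have ht0 : 0 < ‖t‖ := norm_pos_iff.2 ht
  set g : ℚ_[p] → ℝ := fun y => Iker p α t y * (‖y‖ ^ (-γ) * W (-y.valuation)) with hg
  set G : ℚ_[p] → ℝ := fun z =>
    Iker p α 1 z * ‖z‖ ^ (-γ) * W (-t.valuation - z.valuation) with hG
  set h : ℚ_[p] → ℝ := fun z => g (t * z) with hh
  have hV : padicHaar p (closedBall 0 ‖t‖) ≠ ⊤ := measure_closedBall_lt_top.ne
  have hGi : IntegrableOn G {z | ‖z‖ ≤ 1} (padicHaar p) :=
    integrable_HW p α γ hα hγ0 hγ W A hW _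
  have hae : ∀ᵐ z ∂(padicHaar p), ‖t‖ ^ (α - 1 - γ) * G z = h z := by
    have hne : ∀ᵐ z ∂(padicHaar p), z ≠ 1 := by
      rw [ae_iff]; simp
    filter_upwards [hne] with z hz1
    by_cases hz : z = 0
    · simp [hG, hh, hg, hz, Real.zero_rpow (by linarith : -γ ≠ 0)]
    · simp only [hG, hh, hg]
      rw [Iker_scale p α t z ht hz hz1, Padic.valuation_mul ht hz, norm_mul,
        Real.mul_rpow (norm_nonneg _) (norm_nonneg _), sub_eq_add_neg (α - 1) γ,
        Real.rpow_add ht0, neg_add']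
      ring
  have hhi : IntegrableOn h {z | ‖z‖ ≤ 1} (padicHaar p) :=
    (hGi.const_mul (‖t‖ ^ (α - 1 - γ))).congr (ae_restrict_of_ae hae)
  let e : ℚ_[p] ≃ₜ ℚ_[p] := Homeomorph.mulLeft₀ t⁻¹ (inv_ne_zero ht)
  have me : MeasurableEmbedding (fun y : ℚ_[p] => t⁻¹ * y) := e.measurableEmbedding
  have hmap := padicHaar_map p t ht
  have hpre : (fun y : ℚ_[p] => t⁻¹ * y) ⁻¹' {z | ‖z‖ ≤ 1} = {y | ‖y‖ ≤ ‖t‖} := by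
    ext y
    simp only [Set.mem_preimage, Set.mem_ofPred_eq, norm_mul, norm_inv]
    rw [inv_mul_le_iff₀ ht0, mul_one]
  have hcomp : h ∘ (fun y : ℚ_[p] => t⁻¹ * y) = g := by
    funext y
    simp [hh, mul_inv_cancel_left₀ ht]
  constructor
  · rw [← hpre, ← hcomp, ← me.integrableOn_map_iff, hmap]
    unfold IntegrableOn
    rw [Measure.restrict_smul]
    exact Integrable.smul_measure hhi hV
  · have h1 := me.setIntegral_map (μ := padicHaar p) h {z | ‖z‖ ≤ 1}
    rw [hpre, hmap, Measure.restrict_smul, integral_smul_measure] at h1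
    have h2 : ∀ y, h (t⁻¹ * y) = g y := fun y => congrFun hcomp y
    simp only [h2] at h1
    rw [← h1, smul_eq_mul, ← integral_const_mul (‖t‖ ^ (α - 1 - γ))]
    congr 1
    exact (integral_congr_ae (ae_restrict_of_ae hae)).symm

/-- The integral over the unit ball to which the fractional integral reduces by scaling. -/
noncomputable def Jint (p : ℕ) [Fact p.Prime] (α γ : ℝ) (W : ℤ → ℝ) (k : ℤ) : ℝ :=
  ∫ z in {z : ℚ_[p] | ‖z‖ ≤ 1},
    Iker p α 1 z * ‖z‖ ^ (-γ) * W (k - z.valuation) ∂(padicHaar p)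

/-- The scaling coefficient. -/
noncomputable def ccoef (p : ℕ) [Fact p.Prime] (α γ : ℝ) (k : ℤ) : ℝ :=
  Icoef p α * ((padicHaar p (closedBall 0 ((p : ℝ) ^ k))).toReal * ((p : ℝ) ^ k) ^ (α - 1 - γ))

lemma Jint_bound (p : ℕ) [Fact p.Prime] (α γ : ℝ)
    (hα : 0 < α) (hγ0 : 0 < γ) (hγ : γ < min 1 α) (W : ℤ → ℝ) (A : ℝ) (hW : ∀ l, |W l| ≤ A)
    (k : ℤ) :
    |Jint p α γ W k| ≤
      (∫ z in {z : ℚ_[p] | ‖z‖ ≤ 1}, |Iker p α 1 z * ‖z‖ ^ (-γ)| ∂(padicHaar p)) * A := by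
  rw [← integral_mul_const, ← Real.norm_eq_abs]
  unfold Jint
  refine norm_integral_le_of_norm_le ((kernel_integrable p α γ hα hγ0 hγ).abs.mul_const A) ?_
  refine Filter.Eventually.of_forall fun z => ?_
  rw [norm_mul]
  exact mul_le_mul_of_nonneg_left (hW _) (norm_nonneg _)

lemma Jint_sub (p : ℕ) [Fact p.Prime] (α γ : ℝ)
    (hα : 0 < α) (hγ0 : 0 < γ) (hγ : γ < min 1 α) (W W' : ℤ → ℝ) (A : ℝ) (hW : ∀ l, |W l| ≤ A)
    (hW' : ∀ l, |W' l| ≤ A) (k : ℤ) :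
    Jint p α γ W k - Jint p α γ W' k = Jint p α γ (fun l => W l - W' l) k := by
  unfold Jint
  rw [← integral_sub (integrable_HW p α γ hα hγ0 hγ W A hW k)
    (integrable_HW p α γ hα hγ0 hγ W' A hW' k)]
  congr 1
  funext z
  ring

lemma ccoef_bound (p : ℕ) [Fact p.Prime] (α γ : ℝ) (n : ℕ) :
    |ccoef p α γ (-n)| ≤ |Icoef p α| * ((p : ℝ) ^ (-(α - γ))) ^ n := by
  have hp : (0 : ℝ) < p := by exact_mod_cast (Fact.out : p.Prime).pos
  unfold ccoef
  rw [abs_mul]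
  refine mul_le_mul_of_nonneg_left ?_ (abs_nonneg _)
  have hpos : 0 < (p : ℝ) ^ (-n : ℤ) := by positivity
  have h1 : (padicHaar p (closedBall 0 ((p : ℝ) ^ (-n : ℤ)))).toReal ≤ (p : ℝ) ^ (-n : ℤ) :=
    ENNReal.toReal_le_of_le_ofReal hpos.le (padicHaar_ball_le p n)
  rw [abs_of_nonneg (by positivity)]
  calc _ ≤ (p : ℝ) ^ (-n : ℤ) * ((p : ℝ) ^ (-n : ℤ)) ^ (α - 1 - γ) := by gcongr
    _ = ((p : ℝ) ^ (-n : ℤ)) ^ (α - γ) := by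
        have e : α - γ = 1 + (α - 1 - γ) := by ring
        rw [e, Real.rpow_add hpos, Real.rpow_one]
    _ = _ := by
        rw [← Real.rpow_intCast, ← Real.rpow_natCast, ← Real.rpow_mul hp.le, ← Real.rpow_mul hp.le]
        congr 1
        push_cast; ring

/-- local existence of a mild solution of the degenerate Cauchy problem. -/
theorem local_mild_solution_exists (p : ℕ) [Fact p.Prime] (α γ : ℝ)
    (hα : 0 < α) (hγ0 : 0 < γ) (hγ : γ < min 1 α) (u₀ M F : ℝ) (f : ℤ → ℝ → ℝ)
    (hM : ∀ (ℓ : ℤ) (x : ℝ), |f ℓ x| ≤ M)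
    (hF : ∀ (ℓ : ℤ) (x y : ℝ), |f ℓ x - f ℓ y| ≤ F * |x - y|) :
    ∃ (N : ℤ) (u : ℚ_[p] → ℝ), Radial p u ∧ u 0 = u₀ ∧
      ∀ t : ℚ_[p], t ≠ 0 → ‖t‖ ≤ (p : ℝ) ^ N →
        IntegrableOn (fun y => Iker p α t y * (‖y‖ ^ (-γ) * f (-y.valuation) (u y)))
          {y : ℚ_[p] | ‖y‖ ≤ ‖t‖} (padicHaar p) ∧
        u t = u₀ + Iop p α (fun y => ‖y‖ ^ (-γ) * f (-y.valuation) (u y)) t := by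
  have hp1 : (1 : ℝ) < p := by exact_mod_cast (Fact.out : p.Prime).one_lt
  have hp : (0 : ℝ) < p := by linarith
  have hγα : γ < α := lt_of_lt_of_le hγ (min_le_right _ _)
  have hF0 : 0 ≤ F := by
    have := (abs_nonneg _).trans (hF 0 1 0)
    simpa using this
  have hM0 : 0 ≤ M := (abs_nonneg _).trans (hM 0 0)
  set C : ℝ := ∫ z in {z : ℚ_[p] | ‖z‖ ≤ 1}, |Iker p α 1 z * ‖z‖ ^ (-γ)| ∂(padicHaar p) with hC
  have hC0 : 0 ≤ C := integral_nonneg fun z => abs_nonneg _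
  set q : ℝ := (p : ℝ) ^ (-(α - γ)) with hq
  have hq0 : 0 < q := by positivity
  have hq1 : q < 1 := Real.rpow_lt_one_of_one_lt_of_neg hp1 (by linarith)
  set D : ℝ := |Icoef p α| * C * F with hD
  have hD0 : 0 ≤ D := by positivity
  obtain ⟨n, hn⟩ := exists_pow_lt_of_lt_one (by positivity : 0 < 1 / (2 * (D + 1))) hq1
  have hDq : q ^ n * D ≤ 1 / 2 := by
    calc q ^ n * D ≤ 1 / (2 * (D + 1)) * D := by gcongr
      _ ≤ 1 / 2 := by
        rw [div_mul_eq_mul_div, div_le_div_iff₀ (by positivity) (by norm_num)]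
        linarith
  -- bound of the coefficient
  have hck : ∀ k : ℤ, k ≤ -n → |ccoef p α γ k| ≤ |Icoef p α| * q ^ n := by
    intro k hk
    obtain ⟨m, hm⟩ := Int.eq_ofNat_of_zero_le (by omega : 0 ≤ -k)
    obtain rfl : k = -(m : ℤ) := by omega
    refine (ccoef_bound p α γ m).trans (mul_le_mul_of_nonneg_left ?_ (abs_nonneg _))
    exact pow_le_pow_of_le_one hq0.le hq1.le (by omega)
  let Tf : (ℤ → ℝ) → ℤ → ℝ := fun v k =>
    if k ≤ -n then u₀ + ccoef p α γ k * Jint p α γ (fun l => f l (v l)) k else u₀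
  have hTb : ∀ v k, ‖Tf v k‖ ≤ |u₀| + |Icoef p α| * q ^ n * (C * M) := by
    intro v k
    have hnn : 0 ≤ |Icoef p α| * q ^ n * (C * M) := by positivity
    simp only [Tf]
    split_ifs with hk
    · refine (norm_add_le _ _).trans ?_
      rw [norm_mul]
      have h1 := hck k hk
      have h2 := Jint_bound p α γ hα hγ0 hγ (fun l => f l (v l)) M (fun l => hM _ _) k
      simp only [Real.norm_eq_abs]
      gcongr
    · rw [Real.norm_eq_abs]; linarith
  let T : BoundedContinuousFunction ℤ ℝ → BoundedContinuousFunction ℤ ℝ := fun v =>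
    BoundedContinuousFunction.ofNormedAddCommGroupDiscrete (Tf v) _ (hTb v)
  have hT : ContractingWith (1 / 2) T := by
    refine ⟨by rw [← NNReal.coe_lt_coe]; norm_num, LipschitzWith.of_dist_le_mul fun v w => ?_⟩
    rw [BoundedContinuousFunction.dist_le (by positivity)]
    intro k
    change dist (Tf v k) (Tf w k) ≤ _
    simp only [Tf]
    split_ifs with hk
    · rw [dist_add_left, Real.dist_eq, ← mul_sub,
        Jint_sub p α γ hα hγ0 hγ _ _ M (fun l => hM _ _) (fun l => hM _ _), abs_mul]
      have h1 := hck k hk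
      have h2 := Jint_bound p α γ hα hγ0 hγ (fun l => f l (v l) - f l (w l)) (F * dist v w)
        (fun l => (hF _ _ _).trans
          (mul_le_mul_of_nonneg_left
            ((Real.dist_eq _ _).symm.le.trans
              (BoundedContinuousFunction.dist_coe_le_dist (f := v) (g := w) l)) hF0)) k
      calc _ ≤ (|Icoef p α| * q ^ n) * (C * (F * dist v w)) := by gcongr
        _ = (q ^ n * D) * dist v w := by rw [hD]; ring
        _ ≤ 1 / 2 * dist v w := by gcongr
        _ = _ := by norm_num
    · rw [dist_self]; positivity
  obtain ⟨v, hv⟩ : ∃ v, T v = v := ⟨_, hT.fixedPoint_isFixedPt⟩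
  have hvk : ∀ k : ℤ, k ≤ -n →
      v k = u₀ + ccoef p α γ k * Jint p α γ (fun l => f l (v l)) k := by
    intro k hk
    have h : Tf v k = v k := congrArg (fun w : BoundedContinuousFunction ℤ ℝ => w k) hv
    rw [← h]
    simp only [Tf, if_pos hk]
  classical
  refine ⟨-n, fun y => if y = 0 then u₀ else v (-y.valuation), ?_, by simp, ?_⟩
  · intro x y hxy
    have h0 : x = 0 ↔ y = 0 := by rw [← norm_eq_zero, hxy, norm_eq_zero]
    simp only [h0, padic_valuation_eq_floor, hxy]
  intro t ht htN
  have hfun : (fun y : ℚ_[p] => ‖y‖ ^ (-γ) *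
      f (-y.valuation) (if y = 0 then u₀ else v (-y.valuation))) =
      fun y => ‖y‖ ^ (-γ) * (fun l => f l (v l)) (-y.valuation) := by
    funext y
    by_cases hy : y = 0
    · simp [hy, Real.zero_rpow (by linarith : -γ ≠ 0)]
    · simp [hy]
  obtain ⟨hi, he⟩ := scaling p α γ hα hγ0 hγ (fun l => f l (v l)) M (fun l => hM _ _) t ht
  have hnt := Padic.norm_eq_zpow_neg_valuation ht
  constructor
  · have h2 : (fun y : ℚ_[p] => Iker p α t y * (‖y‖ ^ (-γ) *
      f (-y.valuation) (if y = 0 then u₀ else v (-y.valuation)))) =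
      fun y => Iker p α t y * (‖y‖ ^ (-γ) * (fun l => f l (v l)) (-y.valuation)) := by
      funext y
      rw [congrFun hfun y]
    rw [h2]
    exact hi
  · rw [hfun]
    simp only [if_neg ht]
    unfold Iop
    rw [he, hvk (-t.valuation)]
    · unfold ccoef Jint
      rw [hnt]
      ring
    · rw [hnt] at htN
      exact (zpow_le_zpow_iff_right₀ hp1).1 htN
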